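/- arXiv:2309.00496 — 3 statements merged into one kernel-verified Lean document; each statement's English description precedes it below -/
import Mathlib

section
/- Let t ≥ 0, let k, l ≥ 1 be real numbers, and let ξ, η > 0 satisfy ξ ≥ 2tk and η ≥ 2tl. Writing I(t,k,ξ) = ∫₀ᵗ k/(k² + (ξ − k·s)²) ds, one has |exp(I(t,l,η) − I(t,k,ξ)) − 1| ≤ e^{2π}·(2/ξ + 2/η); i.e. the ratio M(t,k,ξ)/M(t,l,η) of multiplier weights differs from 1 by at most a universal constant times 1/ξ + 1/η. -/
open Real

/-- On `[0, t]` with `2 t k ≤ ξ` the frequency `ξ - k s` is at least `ξ / 2`, which bounds the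
exponent of the multiplier weight. -/
theorem weight_exponent_bounds {t k ξ : ℝ} (ht : 0 ≤ t) (hk : 1 ≤ k) (hξ : 0 < ξ)
    (hξt : 2 * t * k ≤ ξ) :
    0 ≤ (∫ s in (0 : ℝ)..t, k / (k ^ 2 + (ξ - k * s) ^ 2)) ∧
    (∫ s in (0 : ℝ)..t, k / (k ^ 2 + (ξ - k * s) ^ 2)) ≤ 2 / ξ ∧
    (∫ s in (0 : ℝ)..t, k / (k ^ 2 + (ξ - k * s) ^ 2)) ≤ 1 / 2 := by
  have hk0 : 0 < k := by linarith
  have hpos : ∀ s : ℝ, 0 < k ^ 2 + (ξ - k * s) ^ 2 := fun s => by positivity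
  have hcont : Continuous fun s : ℝ => k / (k ^ 2 + (ξ - k * s) ^ 2) :=
    continuous_const.div (by fun_prop) fun s => (hpos s).ne'
  have hle : (∫ s in (0 : ℝ)..t, k / (k ^ 2 + (ξ - k * s) ^ 2))
      ≤ t * k / (k ^ 2 + ξ ^ 2 / 4) := by
    have h := intervalIntegral.integral_mono_on ht
      (hcont.intervalIntegrable (μ := MeasureTheory.volume) 0 t)
      (intervalIntegrable_const (c := k / (k ^ 2 + ξ ^ 2 / 4))) fun s hs => by
        have hks : k * s ≤ k * t := mul_le_mul_of_nonneg_left hs.2 hk0.le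
        have hhalf : ξ / 2 ≤ ξ - k * s := by linarith
        have hsq : ξ ^ 2 / 4 ≤ (ξ - k * s) ^ 2 := by nlinarith
        gcongr
    simpa [mul_div_assoc] using h
  refine ⟨intervalIntegral.integral_nonneg ht fun s _ => (div_pos hk0 (hpos s)).le,
    hle.trans ?_, hle.trans ?_⟩
  · rw [div_le_div_iff₀ (by positivity) hξ]
    nlinarith
  · rw [div_le_div_iff₀ (by positivity) two_pos]
    nlinarith [sq_nonneg (ξ - 2)]

/-- Let `t ≥ 0`, `k, l ≥ 1` real, and `ξ, η > 0` with `ξ ≥ 2tk` and `η ≥ 2tl`.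
Writing `I(t,k,ξ) = ∫₀ᵗ k/(k² + (ξ − ks)²) ds`, one has
`|exp(I(t,l,η) − I(t,k,ξ)) − 1| ≤ e^(2π)·(2/ξ + 2/η)`; i.e. the ratio
`M(t,k,ξ)/M(t,l,η)` of multiplier weights differs from `1` by at most a
universal constant times `1/ξ + 1/η`. -/
theorem stmt10 (t k l ξ η : ℝ) (ht : 0 ≤ t) (hk : 1 ≤ k) (hl : 1 ≤ l)
    (hξ : 0 < ξ) (hη : 0 < η) (hξt : 2 * t * k ≤ ξ) (hηt : 2 * t * l ≤ η) :
    |Real.exp ((∫ s in (0 : ℝ)..t, l / (l ^ 2 + (η - l * s) ^ 2))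
        - (∫ s in (0 : ℝ)..t, k / (k ^ 2 + (ξ - k * s) ^ 2))) - 1|
      ≤ Real.exp (2 * π) * (2 / ξ + 2 / η) := by
  obtain ⟨hk_nonneg, hk_le, hk_half⟩ := weight_exponent_bounds ht hk hξ hξt
  obtain ⟨hl_nonneg, hl_le, hl_half⟩ := weight_exponent_bounds ht hl hη hηt
  set I := ∫ s in (0 : ℝ)..t, k / (k ^ 2 + (ξ - k * s) ^ 2)
  set J := ∫ s in (0 : ℝ)..t, l / (l ^ 2 + (η - l * s) ^ 2)
  have hone : |J - I| ≤ 1 := abs_le.2 ⟨by linarith, by linarith⟩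
  have hsum : |J - I| ≤ 2 / ξ + 2 / η := abs_le.2 ⟨by linarith, by linarith⟩
  have hexp : 2 ≤ Real.exp (2 * π) := by
    linarith [Real.add_one_le_exp (2 * π), Real.pi_gt_three]
  calc |Real.exp (J - I) - 1| ≤ 2 * |J - I| := Real.abs_exp_sub_one_le hone
    _ ≤ Real.exp (2 * π) * (2 / ξ + 2 / η) := by gcongr
end

section
/- For every real k ≠ 0, every ξ ∈ ℝ and every t ≥ 0, one has k²·t ≤ 2·√(k² + ξ²)·√(k² + (ξ − kt)²). -/
/-- The Cauchy–Schwarz inequality in the plane, for the vectors `(a, b)` and `(-c, a)`. -/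
lemma mul_sub_le_sqrt_mul_sqrt (a b c : ℝ) :
    a * (b - c) ≤ Real.sqrt (a ^ 2 + b ^ 2) * Real.sqrt (a ^ 2 + c ^ 2) := by
  rw [← Real.sqrt_mul (by positivity)]
  apply Real.le_sqrt_of_sq_le
  nlinarith [sq_nonneg (a ^ 2 + b * c)]

/-- For every real `k ≠ 0`, every `ξ ∈ ℝ` and every `t ≥ 0`, one has
`k²·t ≤ 2·√(k² + ξ²)·√(k² + (ξ − kt)²)`. -/
theorem stmt12 (k ξ t : ℝ) (hk : k ≠ 0) (ht : 0 ≤ t) :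
    k ^ 2 * t ≤ 2 * Real.sqrt (k ^ 2 + ξ ^ 2) * Real.sqrt (k ^ 2 + (ξ - k * t) ^ 2) := by
  have h := mul_sub_le_sqrt_mul_sqrt k ξ (ξ - k * t)
  have h_nonneg : 0 ≤ Real.sqrt (k ^ 2 + ξ ^ 2) * Real.sqrt (k ^ 2 + (ξ - k * t) ^ 2) := by
    positivity
  linarith
end

section
/- Let ν > 0, ξ > 0 and t ≥ 0. Then ∫₀ᵗ (∫_{τ₁}^{t} exp(−ν·((τ₂ − τ₁) + (1/3)·((τ₂ + ξ)³ − (τ₁ + ξ)³))) dτ₂) dτ₁ ≤ 1/(ν·ξ). -/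
theorem integral_exp_neg_mul_sub_le {c : ℝ} (hc : 0 < c) (a b : ℝ) :
    ∫ s in a..b, Real.exp (-c * (s - a)) ≤ 1 / c := by
  have hderiv : ∀ s ∈ Set.uIcc a b,
      HasDerivAt (fun s => -(Real.exp (-c * (s - a)) / c)) (Real.exp (-c * (s - a))) s := by
    intro s _
    have h := (((((hasDerivAt_id' s).sub_const a).const_mul (-c)).exp).div_const c).neg
    refine h.congr_deriv ?_
    field_simp
  rw [intervalIntegral.integral_eq_sub_of_hasDerivAt hderiv
    (Continuous.intervalIntegrable (by fun_prop) _ _)]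
  have : 0 ≤ Real.exp (-c * (b - a)) / c := by positivity
  simp only [sub_self, mul_zero, Real.exp_zero]
  linarith

theorem integral_exp_neg_cubic_le {ν ξ a b : ℝ} (hν : 0 < ν) (ha : 0 < a + ξ) (hab : a ≤ b) :
    ∫ s in a..b, Real.exp (-ν * ((s - a) + (1 / 3) * ((s + ξ) ^ 3 - (a + ξ) ^ 3)))
      ≤ 1 / (ν * (a + ξ) ^ 2) := by
  refine le_trans (intervalIntegral.integral_mono_on hab
    (Continuous.intervalIntegrable (by fun_prop) _ _)
    (Continuous.intervalIntegrable (by fun_prop) _ _) fun s hs => ?_)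
    (integral_exp_neg_mul_sub_le (c := ν * (a + ξ) ^ 2) (by positivity) a b)
  have hu : 0 ≤ s - a := sub_nonneg.2 hs.1
  have hpos : 0 ≤ ν * ((s - a) + (a + ξ) * (s - a) ^ 2 + (s - a) ^ 3 / 3) := by positivity
  refine Real.exp_le_exp.2 ?_
  linear_combination hpos

theorem integral_one_div_mul_add_sq {ν ξ t : ℝ} (hν : 0 < ν) (hξ : 0 < ξ) (ht : 0 ≤ t) :
    IntervalIntegrable (fun x => 1 / (ν * (x + ξ) ^ 2)) MeasureTheory.volume 0 t ∧
      ∫ x in (0 : ℝ)..t, 1 / (ν * (x + ξ) ^ 2) = 1 / (ν * ξ) - 1 / (ν * (t + ξ)) := by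
  have hne : ∀ x ∈ Set.uIcc 0 t, x + ξ ≠ 0 := by
    intro x hx
    rw [Set.uIcc_of_le ht] at hx
    linarith [hx.1]
  have hint : IntervalIntegrable (fun x => 1 / (ν * (x + ξ) ^ 2)) MeasureTheory.volume 0 t := by
    refine ContinuousOn.intervalIntegrable (continuousOn_const.div (by fun_prop) fun x hx => ?_)
    exact mul_ne_zero hν.ne' (pow_ne_zero 2 (hne x hx))
  refine ⟨hint, ?_⟩
  have hderiv : ∀ x ∈ Set.uIcc 0 t,
      HasDerivAt (fun x => -((x + ξ)⁻¹ / ν)) (1 / (ν * (x + ξ) ^ 2)) x := by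
    intro x hx
    have hx' := hne x hx
    have h := ((((hasDerivAt_id' x).add_const ξ).fun_inv hx').div_const ν).neg
    refine h.congr_deriv ?_
    field_simp
  rw [intervalIntegral.integral_eq_sub_of_hasDerivAt hderiv hint]
  have htξ : t + ξ ≠ 0 := by positivity
  rw [zero_add]
  field_simp
  ring

/-- Let `ν > 0`, `ξ > 0` and `t ≥ 0`. Then
`∫₀ᵗ ∫_{τ₁}^{t} exp(−ν((τ₂ − τ₁) + (1/3)((τ₂+ξ)³ − (τ₁+ξ)³))) dτ₂ dτ₁ ≤ 1/(νξ)`. -/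
theorem stmt14 (ν ξ t : ℝ) (hν : 0 < ν) (hξ : 0 < ξ) (ht : 0 ≤ t) :
    (∫ τ₁ in (0 : ℝ)..t, ∫ τ₂ in τ₁..t,
        Real.exp (-ν * ((τ₂ - τ₁) + (1 / 3) * ((τ₂ + ξ) ^ 3 - (τ₁ + ξ) ^ 3))))
      ≤ 1 / (ν * ξ) := by
  obtain ⟨hint, heq⟩ := integral_one_div_mul_add_sq hν hξ ht
  by_cases hf : IntervalIntegrable (fun τ₁ => ∫ τ₂ in τ₁..t,
      Real.exp (-ν * ((τ₂ - τ₁) + (1 / 3) * ((τ₂ + ξ) ^ 3 - (τ₁ + ξ) ^ 3))))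
      MeasureTheory.volume 0 t
  · refine (intervalIntegral.integral_mono_on ht hf hint fun x hx =>
      integral_exp_neg_cubic_le hν (by linarith [hx.1]) hx.2).trans ?_
    rw [heq]
    have : 0 ≤ 1 / (ν * (t + ξ)) := by positivity
    linarith
  · rw [intervalIntegral.integral_undef hf]
    positivity
end
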